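/- For every x ∈ V and every rotor sequence NEXT, there exists a set S of at most 7 positive integers such that for every A ∈ DIR and every ℓ ∈ {1,2,3}, the function t ↦ ∑_{i=0}^{ℓ−1} INF(x, NEXTⁱ(A), t), regarded on the positive integers t with t ≡ x₁ (mod 2), is monotone on each of the intervals into which the elements of S partition [1,∞). (In the paper's terminology: |EX(x)| ≤ 7.) -/

import Mathlib

open Finset

/-- Vertices: we work on `ℤ × ℤ`; the grid `V` consists of points with
`x₁ ≡ x₂ (mod 2)`. -/
abbrev Vtx : Type := ℤ × ℤ

/-- The four diagonal directions. -/
def DIRset : Finset Vtx := {(1,1), (1,-1), (-1,-1), (-1,1)}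

/-- Membership in `V`: both coordinates have the same parity. -/
def inV (x : Vtx) : Prop := x.1 % 2 = x.2 % 2

/-- `H x t`: probability that a random-walk chip starting at `x` is at the
origin after `t` steps. -/
noncomputable def H (x : Vtx) (t : ℕ) : ℝ :=
  if x.1 % 2 = (t : ℤ) % 2 ∧ x.2 % 2 = (t : ℤ) % 2 ∧ |x.1| ≤ (t : ℤ) ∧ |x.2| ≤ (t : ℤ) then
    (4 : ℝ) ^ (-(t : ℤ)) * (Nat.choose t (((t : ℤ) + x.1) / 2).toNat)
      * (Nat.choose t (((t : ℤ) + x.2) / 2).toNat)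
  else 0

/-- `INF x A t := H (x+A) (t-1) - H x t`, for `t ≥ 1`. -/
noncomputable def INF (x A : Vtx) (t : ℕ) : ℝ := H (x + A) (t - 1) - H x t

/-- A function is monotone-or-antitone on a set. -/
def MonoOrAntiOn (g : ℕ → ℝ) (S : Set ℕ) : Prop := MonotoneOn g S ∨ AntitoneOn g S

/-- Unimodal on `X`: monotone up to some `t₁ ∈ X` and monotone from `t₁` on. -/
def UnimodalOn (g : ℕ → ℝ) (X : Set ℕ) : Prop :=
  ∃ t₁ ∈ X, MonoOrAntiOn g (X ∩ Set.Iic t₁) ∧ MonoOrAntiOn g (X ∩ Set.Ici t₁)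

/-- Bimodal on `X`: monotone on `{≤ t₁}`, `[t₁,t₂]` and `{≥ t₂}` for some
`t₁ ≤ t₂` in `X`. -/
def BimodalOn (g : ℕ → ℝ) (X : Set ℕ) : Prop :=
  ∃ t₁ ∈ X, ∃ t₂ ∈ X, t₁ ≤ t₂ ∧ MonoOrAntiOn g (X ∩ Set.Iic t₁) ∧
    MonoOrAntiOn g (X ∩ Set.Icc t₁ t₂) ∧ MonoOrAntiOn g (X ∩ Set.Ici t₂)

/-- Strictly bimodal: bimodal but not unimodal. -/
def StrictlyBimodalOn (g : ℕ → ℝ) (X : Set ℕ) : Prop :=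
  BimodalOn g X ∧ ¬ UnimodalOn g X

/-- The domain of times considered at a vertex `x`: positive integers `t`
with `t ≡ x₁ (mod 2)`. -/
def Xdom (x : Vtx) : Set ℕ := {t : ℕ | 1 ≤ t ∧ (t : ℤ) % 2 = x.1 % 2}

/-- A rotor sequence: a cyclic permutation of the four directions. -/
def IsRotorSequence (next : Vtx → Vtx) : Prop :=
  ∀ A ∈ DIRset, ({A, next A, next^[2] A, next^[3] A} : Finset Vtx) = DIRset

/-- coefficients of the quartic, shifted by u -/
def cf1 (u v c d : ℤ) : ℤ := -16*c*u^3 + 3*u^2*(13*c-6*d+(u^2+v^2)*c) + 2*u*(13*d-12*c+(u^2+v^2)*(d-2*c)) + (4*c-12*d-u^2*v^2*c)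
def cf2 (u v c d : ℤ) : ℤ := -24*c*u^2 + 3*u*(13*c-6*d+(u^2+v^2)*c) + (13*d-12*c+(u^2+v^2)*(d-2*c))
def cf3 (u v c d : ℤ) : ℤ := -16*c*u + (13*c-6*d+(u^2+v^2)*c)

def CaseA (q1 q2 q3 : ℤ) : Prop := (0 ≤ q1 ∧ 0 ≤ q2) ∨ (0 ≤ q1 ∧ q2 ≤ 0 ∧ q3 ≤ 0) ∨ (q1 ≤ 0 ∧ q2 ≤ 0 ∧ q3 ≤ 0)

instance (a b c : ℤ) : Decidable (CaseA a b c) := by unfold CaseA; infer_instance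

lemma small1 : ∀ u < 20, ∀ v < 20, v ≤ u → CaseA (cf1 (u:ℕ) (v:ℕ) (u+v) (-(u*v))) (cf2 u v (u+v) (-(u*v))) (cf3 u v (u+v) (-(u*v))) := by
  decide +kernel

lemma small4 : ∀ u < 20, ∀ v < 20, v ≤ u → CaseA (cf1 (u:ℕ) (v:ℕ) (u-v) (-(u*v))) (cf2 u v (u-v) (-(u*v))) (cf3 u v (u-v) (-(u*v))) ∨ (u < 2 * v ∧ cf1 (u:ℕ) (v:ℕ) (u-v) (-(u*v)) ≤ 0) := by
  decide +kernel

lemma monos (m n u : ℤ) (hm : 0 ≤ m) (hn : 0 ≤ n) (hu : 20 ≤ u) :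
    (0 ≤ (u-20)*m^4 ∧ 0 ≤ (u-20)*(m^3*n) ∧ 0 ≤ (u-20)*(m^2*n^2) ∧ 0 ≤ (u-20)*(m*n^3) ∧ 0 ≤ (u-20)*n^4)
    ∧ (0 ≤ (u-20)*m^3 ∧ 0 ≤ (u-20)*(m^2*n) ∧ 0 ≤ (u-20)*(m*n^2) ∧ 0 ≤ (u-20)*n^3)
    ∧ (0 ≤ (u-20)*m^2 ∧ 0 ≤ (u-20)*(m*n) ∧ 0 ≤ (u-20)*n^2) ∧ (0 ≤ (u-20)*m ∧ 0 ≤ (u-20)*n)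
    ∧ (0 ≤ m^4 ∧ 0 ≤ m^3*n ∧ 0 ≤ m^2*n^2 ∧ 0 ≤ m*n^3 ∧ 0 ≤ n^4)
    ∧ (0 ≤ m^3 ∧ 0 ≤ m^2*n ∧ 0 ≤ m*n^2 ∧ 0 ≤ n^3) ∧ 0 ≤ m^2 ∧ 0 ≤ m*n ∧ 0 ≤ n^2 := by
  have : 0 ≤ u - 20 := by linarith
  refine ⟨⟨?_,?_,?_,?_,?_⟩,⟨?_,?_,?_,?_⟩,⟨?_,?_,?_⟩,⟨?_,?_⟩,⟨?_,?_,?_,?_,?_⟩,⟨?_,?_,?_,?_⟩,?_,?_,?_⟩ <;> positivity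

lemma big1a (u v : ℤ) (hv : 0 ≤ v) (hu : 20 ≤ u) (h : v ≤ u) : 0 ≤ cf1 u v (u+v) (-(u*v)) := by
  obtain ⟨w, rfl⟩ : ∃ w, u = v + w := ⟨u - v, by ring⟩
  unfold cf1
  have hw : 0 ≤ w := by linarith
  obtain ⟨⟨_,_,_,_,_⟩,⟨_,_,_,_⟩,⟨_,_,_⟩,⟨_,_⟩,⟨_,_,_,_,_⟩,⟨_,_,_,_⟩,_,_,_⟩ := monos v w _ hv hw hu
  linarith

lemma big1b (u v : ℤ) (hv : 0 ≤ v) (hu : 20 ≤ u) (h : v ≤ u) : 0 ≤ cf2 u v (u+v) (-(u*v)) := by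
  obtain ⟨w, rfl⟩ : ∃ w, u = v + w := ⟨u - v, by ring⟩
  unfold cf2
  have hw : 0 ≤ w := by linarith
  obtain ⟨⟨_,_,_,_,_⟩,⟨_,_,_,_⟩,⟨_,_,_⟩,⟨_,_⟩,⟨_,_,_,_,_⟩,⟨_,_,_,_⟩,_,_,_⟩ := monos v w _ hv hw hu
  linarith

lemma big4a (u v : ℤ) (hv : 0 ≤ v) (hu : 20 ≤ u) (h : 2 * v ≤ u) : 0 ≤ cf1 u v (u-v) (-(u*v)) := by
  obtain ⟨w, rfl⟩ : ∃ w, u = 2 * v + w := ⟨u - 2 * v, by ring⟩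
  unfold cf1
  have hw : 0 ≤ w := by linarith
  obtain ⟨⟨_,_,_,_,_⟩,⟨_,_,_,_⟩,⟨_,_,_⟩,⟨_,_⟩,⟨_,_,_,_,_⟩,⟨_,_,_,_⟩,_,_,_⟩ := monos v w _ hv hw hu
  linarith

/- here w = 2u - 3v, scaled by 16 -/
lemma big4b (u v : ℤ) (hv : 0 ≤ v) (hu : 20 ≤ u) (h : 3 * v ≤ 2 * u) : 0 ≤ cf2 u v (u-v) (-(u*v)) := by
  obtain ⟨w, hw⟩ : ∃ w, w = 2 * u - 3 * v := ⟨_, rfl⟩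
  have hw0 : 0 ≤ w := by linarith
  obtain ⟨⟨_,_,_,_,_⟩,⟨_,_,_,_⟩,⟨_,_,_⟩,⟨_,_⟩,⟨_,_,_,_,_⟩,⟨_,_,_,_⟩,_,_,_⟩ := monos v w u hv hw0 hu
  subst hw
  unfold cf2
  linarith

lemma big4c (u v : ℤ) (hvu : v ≤ u) (hu : 20 ≤ u) (h : 2 * u ≤ 3 * v) : cf1 u v (u-v) (-(u*v)) ≤ 0 := by
  obtain ⟨w, hw⟩ : ∃ w, w = 3 * v - 2 * u := ⟨_, rfl⟩
  obtain ⟨m, hm⟩ : ∃ m, m = u - v := ⟨_, rfl⟩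
  have hw0 : 0 ≤ w := by linarith
  have hm0 : 0 ≤ m := by linarith
  obtain ⟨⟨_,_,_,_,_⟩,⟨_,_,_,_⟩,⟨_,_,_⟩,⟨_,_⟩,⟨_,_,_,_,_⟩,⟨_,_,_,_⟩,_,_,_⟩ := monos m w u hm0 hw0 hu
  subst hw
  subst hm
  unfold cf1
  linarith

lemma caseA1 (u v : ℤ) (hv : 0 ≤ v) (h : v ≤ u) :
    CaseA (cf1 u v (u+v) (-(u*v))) (cf2 u v (u+v) (-(u*v))) (cf3 u v (u+v) (-(u*v))) := by
  by_cases hu : 20 ≤ u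
  · exact Or.inl ⟨big1a u v hv hu h, big1b u v hv hu h⟩
  · lift v to ℕ using hv
    lift u to ℕ using (by omega)
    exact small1 u (by omega) v (by omega) (by omega)

lemma caseA4 (u v : ℤ) (hv : 0 ≤ v) (h : v ≤ u) :
    CaseA (cf1 u v (u-v) (-(u*v))) (cf2 u v (u-v) (-(u*v))) (cf3 u v (u-v) (-(u*v))) ∨
      (u < 2 * v ∧ cf1 u v (u-v) (-(u*v)) ≤ 0) := by
  by_cases hu : 20 ≤ u
  · by_cases h1 : 3 * v ≤ 2 * u
    · have hb := big4b u v hv hu h1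
      by_cases h2 : 2 * v ≤ u
      · exact Or.inl (Or.inl ⟨big4a u v hv hu h2, hb⟩)
      · by_cases h3 : 0 ≤ cf1 u v (u-v) (-(u*v))
        · exact Or.inl (Or.inl ⟨h3, hb⟩)
        · right; constructor <;> linarith
    · right
      refine ⟨by omega, big4c u v h hu (by omega)⟩
  · lift v to ℕ using hv
    lift u to ℕ using (by omega)
    have := small4 u (by omega) v (by omega) (by omega)
    exact_mod_cast this

/-- the quartic -/
def QQ (u v c d s : ℝ) : ℝ := (s-1)^2*(s-2)^2*(c*s+d) - (s^2-u^2)*(s^2-v^2)*(c*(s-2)+d)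

lemma conc (q0 q1 q2 q3 q4 p s r : ℝ) (hp : 0 < p) (hs : p < s) (hr : s < r)
    (h : q4 * (p*s*r)^2 + q1 * (p*s*r) + q0 * (p*s+p*r+s*r) ≤ 0)
    (h1 : 0 ≤ q0 + q1*p + q2*p^2 + q3*p^3 + q4*p^4)
    (h2 : q0 + q1*s + q2*s^2 + q3*s^3 + q4*s^4 < 0) :
    q0 + q1*r + q2*r^2 + q3*r^3 + q4*r^4 ≤ 0 := by
  by_contra! h3
  have key : (r-s)*s^2*r^2*(q0 + q1*p + q2*p^2 + q3*p^3 + q4*p^4)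
     + (s-p)*p^2*s^2*(q0 + q1*r + q2*r^2 + q3*r^3 + q4*r^4)
     - (r-p)*p^2*r^2*(q0 + q1*s + q2*s^2 + q3*s^3 + q4*s^4)
     = (r-s)*(s-p)*(r-p)*(q4 * (p*s*r)^2 + q1 * (p*s*r) + q0 * (p*s+p*r+s*r)) := by ring
  have a1 : 0 < r - s := by linarith
  have a2 : 0 < s - p := by linarith
  have a3 : 0 < r - p := by linarith
  have a4 : 0 < s := by linarith
  have a5 : 0 < r := by linarith
  have b1 : 0 ≤ (r-s)*s^2*r^2*(q0 + q1*p + q2*p^2 + q3*p^3 + q4*p^4) := by positivity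
  have b2 : 0 < (s-p)*p^2*s^2*(q0 + q1*r + q2*r^2 + q3*r^3 + q4*r^4) := by positivity
  have b3 : 0 < (r-p)*p^2*r^2*(-(q0 + q1*s + q2*s^2 + q3*s^3 + q4*s^4)) := by
    apply mul_pos (by positivity); linarith
  have b4 : (r-s)*(s-p)*(r-p)*(q4 * (p*s*r)^2 + q1 * (p*s*r) + q0 * (p*s+p*r+s*r)) ≤ 0 :=
    mul_nonpos_of_nonneg_of_nonpos (by positivity) h
  linarith

lemma onesign (q1 q2 q3 q4 a b : ℝ) (ha : 0 < a) (hab : a < b) (h4 : q4 ≤ 0)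
    (h : (0 ≤ q1 ∧ 0 ≤ q2) ∨ (0 ≤ q1 ∧ q2 ≤ 0 ∧ q3 ≤ 0) ∨ (q1 ≤ 0 ∧ q2 ≤ 0 ∧ q3 ≤ 0))
    (h1 : q1 + q2*a + q3*a^2 + q4*a^3 < 0) : q1 + q2*b + q3*b^2 + q4*b^3 ≤ 0 := by
  by_contra! h2
  have hb : 0 < b := by linarith
  have hd : 0 < b - a := by linarith
  have n1 : q4 * (b - a) ≤ 0 := mul_nonpos_of_nonpos_of_nonneg h4 hd.le
  rcases h with ⟨hq1, hq2⟩ | ⟨hq1, hq2, hq3⟩ | ⟨hq1, hq2, hq3⟩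
  · -- divide by y^2
    have e : a^2*(q1 + q2*b + q3*b^2 + q4*b^3) - b^2*(q1 + q2*a + q3*a^2 + q4*a^3)
      = -((b-a)*(a+b)*q1) - (b-a)*a*b*q2 + (q4*(b-a))*a^2*b^2 := by ring
    have c1 : 0 < a^2*(q1 + q2*b + q3*b^2 + q4*b^3) := by positivity
    have c2 : 0 < b^2*(-(q1 + q2*a + q3*a^2 + q4*a^3)) := mul_pos (by positivity) (by linarith)
    have c3 : 0 ≤ (b-a)*(a+b)*q1 := by positivity
    have c4 : 0 ≤ (b-a)*a*b*q2 := by positivity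
    have c5 : (q4*(b-a))*a^2*b^2 ≤ 0 := by
      rw [mul_assoc]; exact mul_nonpos_of_nonpos_of_nonneg n1 (by positivity)
    linarith
  · have e1 : q2 * b ≤ q2 * a := mul_le_mul_of_nonpos_left hab.le hq2
    have e2 : q3 * b^2 ≤ q3 * a^2 := mul_le_mul_of_nonpos_left (by gcongr) hq3
    have e3 : q4 * b^3 ≤ q4 * a^3 := mul_le_mul_of_nonpos_left (by gcongr) h4
    linarith
  · have e1 : q2 * b ≤ q2 * a := mul_le_mul_of_nonpos_left hab.le hq2
    have e2 : q3 * b^2 ≤ q3 * a^2 := mul_le_mul_of_nonpos_left (by gcongr) hq3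
    have e3 : q4 * b^3 ≤ q4 * a^3 := mul_le_mul_of_nonpos_left (by gcongr) h4
    linarith

lemma caseA_lem (q0 q1 q2 q3 q4 p s r : ℝ) (hp : 0 ≤ p) (hs : p < s) (hr : s < r) (h4 : q4 ≤ 0)
    (h : (0 ≤ q1 ∧ 0 ≤ q2) ∨ (0 ≤ q1 ∧ q2 ≤ 0 ∧ q3 ≤ 0) ∨ (q1 ≤ 0 ∧ q2 ≤ 0 ∧ q3 ≤ 0))
    (h1 : 0 ≤ q0 + q1*p + q2*p^2 + q3*p^3 + q4*p^4)
    (h2 : q0 + q1*s + q2*s^2 + q3*s^3 + q4*s^4 < 0) :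
    q0 + q1*r + q2*r^2 + q3*r^3 + q4*r^4 ≤ 0 := by
  by_contra! h3
  have hd : ∀ y : ℝ, HasDerivAt (fun y : ℝ => q0 + q1*y + q2*y^2 + q3*y^3 + q4*y^4)
      (q1 + (2*q2)*y + (3*q3)*y^2 + (4*q4)*y^3) y := by
    intro y
    have h1 := ((((hasDerivAt_const y q0).add ((hasDerivAt_id y).const_mul q1)).add
      ((hasDerivAt_pow 2 y).const_mul q2)).add ((hasDerivAt_pow 3 y).const_mul q3)).add
      ((hasDerivAt_pow 4 y).const_mul q4)
    refine (h1.congr_deriv ?_)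
    push_cast; ring
  have hc : Continuous (fun y : ℝ => q0 + q1*y + q2*y^2 + q3*y^3 + q4*y^4) := by fun_prop
  obtain ⟨x1, ⟨hx1, hx1'⟩, e1⟩ := exists_hasDerivAt_eq_slope _ _ hs hc.continuousOn (fun y _ => hd y)
  obtain ⟨x2, ⟨hx2, hx2'⟩, e2⟩ := exists_hasDerivAt_eq_slope _ _ hr hc.continuousOn (fun y _ => hd y)
  have n1 : q1 + (2*q2)*x1 + (3*q3)*x1^2 + (4*q4)*x1^3 < 0 := by
    rw [e1]; apply div_neg_of_neg_of_pos <;> linarith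
  have n2 : 0 < q1 + (2*q2)*x2 + (3*q3)*x2^2 + (4*q4)*x2^3 := by
    rw [e2]; apply div_pos <;> linarith
  have := onesign q1 (2*q2) (3*q3) (4*q4) x1 x2 (by linarith) (by linarith) (by linarith) (by
    rcases h with ⟨hq1, hq2⟩ | ⟨hq1, hq2, hq3⟩ | ⟨hq1, hq2, hq3⟩
    · left; constructor <;> linarith
    · right; left; refine ⟨?_, ?_, ?_⟩ <;> linarith
    · right; right; refine ⟨?_, ?_, ?_⟩ <;> linarith) n1
  linarith

lemma QQ_shift (u v c d : ℤ) (s : ℝ) : QQ u v c d s =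
    ((u-1)^2*(u-2)^2*(c*u+d) : ℤ) + (cf1 u v c d : ℤ)*(s-u) + (cf2 u v c d : ℤ)*(s-u)^2
      + (cf3 u v c d : ℤ)*(s-u)^3 + (-4*c : ℤ)*(s-u)^4 := by
  unfold QQ cf1 cf2 cf3; push_cast; ring

/-- F1 -/
lemma QQ_F1 (u v : ℤ) (hv : 0 ≤ v) (h : v ≤ u) (s r : ℝ) (hs : u ≤ s) (hr : s < r)
    (hn : QQ u v (u+v) (-(u*v)) s < 0) : QQ u v (u+v) (-(u*v)) r ≤ 0 := by
  have hA := caseA1 u v hv h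
  have e := QQ_shift u v (u+v) (-(u*v))
  push_cast at e
  rw [e] at hn ⊢
  have hv' : (0:ℝ) ≤ v := by exact_mod_cast hv
  have hu' : (v:ℝ) ≤ u := by exact_mod_cast h
  have h0 : (0:ℝ) ≤ ((u:ℝ)-1)^2*((u:ℝ)-2)^2*((u+v)*u+-(u*v)) := by
    have : (0:ℝ) ≤ (u+v)*u+-(u*v) := by nlinarith
    positivity
  have hsu : (u:ℝ) < s := by
    rcases hs.lt_or_eq with h | h
    · exact h
    · rw [← h] at hn; simp at hn; linarith
  refine caseA_lem _ _ _ _ _ 0 (s-u) (r-u) le_rfl (by linarith) (by linarith) (by linarith) ?_ ?_ hn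
  · unfold CaseA at hA; exact_mod_cast hA
  · simpa using h0

lemma QQ_F4 (u v : ℤ) (hv : 0 ≤ v) (h : v ≤ u) (p s r : ℝ) (hp : u ≤ p) (hs : p < s) (hr : s < r)
    (hpp : 0 < QQ u v (u-v) (-(u*v)) p)
    (hn : QQ u v (u-v) (-(u*v)) s < 0) : QQ u v (u-v) (-(u*v)) r ≤ 0 := by
  have hA := caseA4 u v hv h
  have e := QQ_shift u v (u-v) (-(u*v))
  push_cast at e
  rw [e] at hn hpp ⊢
  have hv' : (0:ℝ) ≤ v := by exact_mod_cast hv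
  have hu' : (v:ℝ) ≤ u := by exact_mod_cast h
  rcases hA with hA | ⟨hA, hB⟩
  · refine caseA_lem _ _ _ _ _ (p-u) (s-u) (r-u) (by linarith) (by linarith) (by linarith) (by linarith) ?_ hpp.le hn
    unfold CaseA at hA; exact_mod_cast hA
  · have hA' : (u:ℝ) < 2*v := by exact_mod_cast hA
    have h0 : ((u:ℝ)-1)^2*((u:ℝ)-2)^2*((u-v)*u+-(u*v)) ≤ 0 :=
      mul_nonpos_of_nonneg_of_nonpos (by positivity) (by nlinarith)
    have h1 : ((cf1 u v (u-v) (-(u*v)) : ℤ) : ℝ) ≤ 0 := by exact_mod_cast hB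
    have hpu : (u:ℝ) < p := by
      rcases hp.lt_or_eq with h | h
      · exact h
      · rw [← h] at hpp; simp at hpp; linarith
    have a1 : 0 < p - u := by linarith
    have a2 : 0 < s - u := by linarith
    have a3 : 0 < r - u := by linarith
    refine conc _ _ _ _ _ (p-u) (s-u) (r-u) a1 (by linarith) (by linarith) ?_ hpp.le hn
    have c1 : (-4*((u:ℝ)-v)) * ((p-u)*(s-u)*(r-u))^2 ≤ 0 := mul_nonpos_of_nonpos_of_nonneg (by linarith) (by positivity)
    have c2 : ((cf1 u v (u-v) (-(u*v)) : ℤ) : ℝ) * ((p-u)*(s-u)*(r-u)) ≤ 0 := mul_nonpos_of_nonpos_of_nonneg h1 (by positivity)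
    have c3 : ((u:ℝ)-1)^2*((u:ℝ)-2)^2*((u-v)*u+-(u*v)) * ((p-u)*(s-u)+(p-u)*(r-u)+(s-u)*(r-u)) ≤ 0 := mul_nonpos_of_nonpos_of_nonneg h0 (by positivity)
    linarith

set_option maxHeartbeats 1000000 in
lemma QQ_pos (u v : ℤ) (c d : ℝ) (hv : 0 ≤ v) (h : v ≤ u) (hu : 1 ≤ u) (hc : 0 ≤ c) (hd : 0 ≤ d)
    (s r : ℝ) (hs : u ≤ s) (hs3 : 3 ≤ s) (hr : s < r)
    (hn : QQ u v c d s < 0) : QQ u v c d r ≤ 0 := by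
  have e : ∀ s : ℝ, QQ u v c d s = (4*d+(u:ℝ)^2*v^2*(2*c-d)) + (4*c-12*d-(u:ℝ)^2*v^2*c)*s
     + (13*d-12*c+((u:ℝ)^2+v^2)*(d-2*c))*s^2 + (13*c-6*d+((u:ℝ)^2+v^2)*c)*s^3 + (-4*c)*s^4 := by
    intro s; unfold QQ; ring
  have hv' : (0:ℝ) ≤ v := by exact_mod_cast hv
  have hu' : (v:ℝ) ≤ u := by exact_mod_cast h
  have hu1 : (1:ℝ) ≤ u := by exact_mod_cast hu
  have h0 : 0 ≤ QQ u v c d u := by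
    have : QQ u v c d u = ((u:ℝ)-1)^2*((u:ℝ)-2)^2*(c*u+d) := by unfold QQ; ring
    rw [this]; positivity
  have hsu : (u:ℝ) < s := by
    rcases hs.lt_or_eq with h | h
    · exact h
    · rw [← h] at hn; linarith
  rw [e] at hn h0 ⊢
  refine conc _ _ _ _ _ (u:ℝ) s r (by linarith) hsu hr ?_ h0 hn
  generalize hU : (u:ℝ) = U at *
  generalize hV : (v:ℝ) = V at *
  have hs0 : 0 < s := by linarith
  have hr0 : 0 < r := by linarith
  have hU0 : 0 < U := by linarith
  have hY9 : 9 ≤ s*r := by nlinarith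
  have hYU : U^2 ≤ s*r := by nlinarith
  have hus : U*s ≤ s*r := by nlinarith
  have hur : U*r ≤ s*r := by nlinarith
  have hYX : s*r ≤ U*s*r := by nlinarith
  have hX1 : U*s ≤ U*s*r := by nlinarith [mul_pos hU0 hs0]
  have hX2 : U*r ≤ U*s*r := by nlinarith [mul_pos hU0 hr0]
  have hM0 : 0 ≤ U^2*V^2 := by positivity
  have hM : U^2*V^2 ≤ U^4 := by
    have : V^2 ≤ U^2 := by gcongr
    calc U^2*V^2 ≤ U^2*U^2 := by gcongr
      _ = U^4 := by ring
  have dpart : -12*(U*s*r) + (4 - U^2*V^2)*(U*s+U*r+s*r) ≤ 0 := by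
    have : 0 ≤ U^2*V^2*(U*s+U*r+s*r) := by positivity
    linarith
  have small : U^3*(6-U)+4 ≤ 4*U*(s*r) := by
    have : u = 1 ∨ u = 2 ∨ 3 ≤ u := by omega
    rcases this with h1 | h1 | h1
    · subst h1; norm_num at hU; subst hU; linarith
    · subst h1; norm_num at hU; subst hU; linarith
    · have h3 : (3:ℝ) ≤ U := by rw [← hU]; exact_mod_cast h1
      have : 4*U*U^2 ≤ 4*U*(s*r) := by gcongr
      have h27 : 27 ≤ U^3 := by nlinarith
      nlinarith
  have cpart : -4*(U*s*r)^2 + (4 - U^2*V^2)*(U*s*r) + 2*(U^2*V^2)*(U*s+U*r+s*r) ≤ 0 := by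
    have hXbig : 1 ≤ U*s*r := by linarith
    by_cases hh : 2*(U*s+U*r+s*r) ≤ U*s*r
    · have : U^2*V^2*(2*(U*s+U*r+s*r)) ≤ U^2*V^2*(U*s*r) := by gcongr
      have hsq : (U*s*r)*1 ≤ (U*s*r)*(U*s*r) := mul_le_mul_of_nonneg_left hXbig (by linarith)
      linarith
    · push Not at hh
      have k1 : U^2*V^2*(2*(U*s+U*r+s*r)-U*s*r) ≤ U^4*(2*(U*s+U*r+s*r)-U*s*r) := by
        apply mul_le_mul_of_nonneg_right hM; linarith
      have k2 : U^4*(2*(U*s+U*r+s*r)-U*s*r) ≤ U^4*(6*(s*r)-U*(s*r)) := by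
        apply mul_le_mul_of_nonneg_left _ (by positivity); linarith
      have k3 : (U*(s*r))*(U^3*(6-U)+4) ≤ (U*(s*r))*(4*U*(s*r)) := by
        apply mul_le_mul_of_nonneg_left small; positivity
      linarith
  linarith [mul_nonneg hc (sub_nonneg.2 cpart), mul_nonneg hd (sub_nonneg.2 dpart)]

/-- binomial with cutoff -/
noncomputable def hb (n : ℤ) (t : ℕ) : ℝ :=
  if |n| ≤ (t:ℤ) then (Nat.choose t (((t:ℤ) + n) / 2).toNat : ℝ) else 0

lemma hb_neg (n : ℤ) (t : ℕ) (hp : n % 2 = (t:ℤ) % 2) : hb (-n) t = hb n t := by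
  unfold hb
  rw [abs_neg]
  split_ifs with h
  · rw [abs_le] at h
    have e : (((t:ℤ) + -n) / 2).toNat = t - (((t:ℤ) + n) / 2).toNat := by omega
    rw [e, Nat.choose_symm (by omega)]
  · rfl

lemma hb_up (n : ℤ) (t : ℕ) (hp : n % 2 = ((t+1:ℕ):ℤ) % 2) :
    hb (n+1) t * (2*((t+1:ℕ):ℝ)) = hb n (t+1) * (((t+1:ℕ):ℝ) - n) := by
  unfold hb
  by_cases h : |n| ≤ ((t+1:ℕ):ℤ)
  · rw [if_pos h]
    rw [abs_le] at h
    obtain ⟨k, hk⟩ : ∃ k : ℕ, n = 2 * (k:ℤ) - ((t+1:ℕ):ℤ) :=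
      ⟨((((t+1:ℕ):ℤ) + n) / 2).toNat, by omega⟩
    have e1 : ((((t+1:ℕ):ℤ) + n) / 2).toNat = k := by omega
    have e2 : (((t:ℤ) + (n+1)) / 2).toNat = k := by omega
    rw [e1, e2]
    by_cases hk' : k = t + 1
    · have : ¬ (|n+1| ≤ (t:ℤ)) := by rw [abs_le]; omega
      rw [if_neg this, hk, hk']; push_cast; ring
    · have hkt : k ≤ t := by omega
      have : (|n+1| ≤ (t:ℤ)) := by rw [abs_le]; omega
      rw [if_pos this]
      have c := Nat.choose_mul_succ_eq t k
      have c' : (t.choose k : ℝ) * ((t+1:ℕ):ℝ) = ((t+1).choose k : ℝ) * ((t+1:ℕ) - (k:ℝ)) := by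
        rw [← Nat.cast_sub (by omega)]; exact_mod_cast c
      rw [hk]; push_cast at c' ⊢; linarith
  · have : ¬ (|n+1| ≤ (t:ℤ)) := by rw [abs_le] at h ⊢; omega
    rw [if_neg h, if_neg this]; simp

lemma hb_down (n : ℤ) (t : ℕ) (hp : n % 2 = ((t+1:ℕ):ℤ) % 2) :
    hb (n-1) t * (2*((t+1:ℕ):ℝ)) = hb n (t+1) * (((t+1:ℕ):ℝ) + n) := by
  have := hb_up (-n) t (by omega)
  rw [hb_neg n _ hp] at this
  have e : -n + 1 = -(n-1) := by ring
  rw [e, hb_neg _ _ (by omega)] at this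
  push_cast at this ⊢; linarith

lemma hb_two (n : ℤ) (t : ℕ) (hp : n % 2 = (t:ℤ) % 2) :
    hb n t * (4*((t:ℝ)+2)*((t:ℝ)+1)) = hb n (t+2) * (((t:ℝ)+2)^2 - (n:ℝ)^2) := by
  have h1 := hb_up n (t+1) (by push_cast; omega)
  have h2 := hb_down (n+1) t (by push_cast; omega)
  have e : n + 1 - 1 = n := by ring
  rw [e] at h2
  push_cast at h1 h2
  have : hb n (t+1+1) * (((t:ℝ)+2)^2 - (n:ℝ)^2) = (hb n (t+1+1) * ((t:ℝ)+1+1-n))*((t:ℝ)+2+n) := by ring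
  show _ = hb n (t+1+1) * _
  rw [this, ← h1]
  linear_combination 2 * ((t:ℝ)+2) * h2

lemma H_eq (x : Vtx) (t : ℕ) (h1 : x.1 % 2 = (t:ℤ) % 2) (h2 : x.2 % 2 = (t:ℤ) % 2) :
    H x t = ((4:ℝ)^t)⁻¹ * hb x.1 t * hb x.2 t := by
  unfold H hb
  by_cases a : |x.1| ≤ (t:ℤ) <;> by_cases b : |x.2| ≤ (t:ℤ) <;> simp [h1, h2, a, b]

lemma H_nonneg (x : Vtx) (t : ℕ) : 0 ≤ H x t := by
  unfold H; split_ifs <;> positivity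

lemma H_zero (x : Vtx) (t : ℕ) (h : (t:ℤ) < max |x.1| |x.2|) : H x t = 0 := by
  unfold H; rw [if_neg]; rintro ⟨_, _, a, b⟩
  have := max_le a b; omega

lemma H_step (x : Vtx) (t : ℕ) (h1 : x.1 % 2 = (t:ℤ) % 2) (h2 : x.2 % 2 = (t:ℤ) % 2) :
    H x t * (((t:ℝ)+2)^2*((t:ℝ)+1)^2) =
      H x (t+2) * ((((t:ℝ)+2)^2 - (x.1:ℝ)^2) * (((t:ℝ)+2)^2 - (x.2:ℝ)^2)) := by
  rw [H_eq x t h1 h2, H_eq x (t+2) (by push_cast; omega) (by push_cast; omega)]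
  have a := hb_two x.1 t h1
  have b := hb_two x.2 t h2
  have e : ((4:ℝ)^(t+2))⁻¹ = ((4:ℝ)^t)⁻¹ * (1/16) := by rw [pow_add, mul_inv]; norm_num
  rw [e]
  calc _ = ((4:ℝ)^t)⁻¹ * (1/16) * (hb x.1 t * (4*((t:ℝ)+2)*((t:ℝ)+1))) * (hb x.2 t * (4*((t:ℝ)+2)*((t:ℝ)+1))) := by ring
    _ = _ := by rw [a, b]; ring

/-- the normalised functions -/
noncomputable def GG (x : Vtx) (c d : ℝ) (t : ℕ) : ℝ := H x t * (c * t + d) / (t:ℝ)^2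

lemma hb_dir (n a : ℤ) (ha : a = 1 ∨ a = -1) (t : ℕ) (hp : n % 2 = ((t+1:ℕ):ℤ) % 2) :
    hb (n+a) t * (2*((t+1:ℕ):ℝ)) = hb n (t+1) * (((t+1:ℕ):ℝ) - a * n) := by
  rcases ha with rfl | rfl
  · simpa using hb_up n t hp
  · have := hb_down n t hp
    simpa [sub_eq_add_neg] using this

lemma mem_DIR {A : Vtx} (hA : A ∈ DIRset) : (A.1 = 1 ∨ A.1 = -1) ∧ (A.2 = 1 ∨ A.2 = -1) := by
  simp only [DIRset, Finset.mem_insert, Finset.mem_singleton] at hA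
  rcases hA with rfl | rfl | rfl | rfl <;> simp

lemma INF_eq (x A : Vtx) (hx : inV x) (hA : A ∈ DIRset) (t : ℕ) (ht : t ∈ Xdom x) :
    INF x A t = GG x (-(A.1*x.1+A.2*x.2 : ℤ)) (A.1*A.2*x.1*x.2 : ℤ) t := by
  obtain ⟨h1, hp⟩ := ht
  obtain ⟨ha1, ha2⟩ := mem_DIR hA
  unfold inV at hx
  obtain ⟨k, rfl⟩ : ∃ k, t = k + 1 := ⟨t-1, by omega⟩
  unfold INF GG
  rw [Nat.add_sub_cancel, H_eq x (k+1) (by omega) (by omega)]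
  rw [H_eq (x+A) k (by simp only [Prod.fst_add]; omega) (by simp only [Prod.snd_add]; omega)]
  have a := hb_dir x.1 A.1 ha1 k (by omega)
  have b := hb_dir x.2 A.2 ha2 k (by omega)
  simp only [Prod.fst_add, Prod.snd_add]
  have hk : ((k+1:ℕ):ℝ) ≠ 0 := by positivity
  have e : ((4:ℝ)^(k+1))⁻¹ = ((4:ℝ)^k)⁻¹ * (1/4) := by rw [pow_add, mul_inv]; norm_num
  rw [e, eq_div_iff (by positivity)]
  generalize ((k+1:ℕ):ℝ) = T at *
  push_cast
  linear_combination (1/4*((4:ℝ)^k)⁻¹ * hb (x.2 + A.2) k * (2*T)) * a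
    + (1/4*((4:ℝ)^k)⁻¹ * hb x.1 (k+1) * (T - A.1*x.1)) * b

lemma GG_step (x : Vtx) (hx : inV x) (c d : ℝ) (s : ℕ) (hs : s ∈ Xdom x) (h3 : 3 ≤ s) :
    GG x c d s - GG x c d (s-2) =
      H x s * QQ (max |x.1| |x.2| : ℤ) (min |x.1| |x.2| : ℤ) c d s / ((s:ℝ)^2*((s:ℝ)-1)^2*((s:ℝ)-2)^2) := by
  obtain ⟨h1, hp⟩ := hs
  unfold inV at hx
  obtain ⟨k, rfl⟩ : ∃ k, s = k + 2 := ⟨s-2, by omega⟩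
  rw [Nat.add_sub_cancel]
  have hq : ∀ z : ℝ, (z^2 - ((max |x.1| |x.2| : ℤ):ℝ)^2) * (z^2 - ((min |x.1| |x.2| : ℤ):ℝ)^2)
     = (z^2 - (x.1:ℝ)^2) * (z^2 - (x.2:ℝ)^2) := by
    intro z
    rcases le_total |x.1| |x.2| with h | h
    · rw [max_eq_right h, min_eq_left h]; push_cast; rw [sq_abs, sq_abs]; ring
    · rw [max_eq_left h, min_eq_right h]; push_cast; rw [sq_abs, sq_abs]
  have st := H_step x k (by omega) (by omega)
  have hk : (0:ℝ) < k := by exact_mod_cast (by omega : 0 < k)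
  unfold GG QQ
  rw [hq]
  push_cast
  have e1 : (k:ℝ) + 2 - 1 = k + 1 := by ring
  have e2 : (k:ℝ) + 2 - 2 = k := by ring
  rw [e1, e2]
  have n2 : (k:ℝ) + 2 ≠ 0 := by positivity
  have n1 : (k:ℝ) + 1 ≠ 0 := by positivity
  rw [div_sub_div _ _ (by positivity) (by positivity), div_eq_div_iff (by positivity) (by positivity)]
  linear_combination (-(c*k+d) * ((k:ℝ)+2)^2*(k:ℝ)^2) * st

/-- `S` splits `g` into monotone pieces on `X` -/
def Good (g : ℕ → ℝ) (X : Set ℕ) (S : Finset ℕ) : Prop :=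
  ∀ a b : ℕ, 1 ≤ a → (∀ s ∈ S, ¬(a < s ∧ s < b)) → MonoOrAntiOn g (X ∩ Set.Icc a b)

lemma Good.mono {g X S S'} (h : Good g X S) (hS : S ⊆ S') : Good g X S' :=
  fun a b ha hs => h a b ha (fun s hs' => hs s (hS hs'))

lemma Good.congr {g g' X S} (h : Good g X S) (e : ∀ t ∈ X, g' t = g t) : Good g' X S := by
  intro a b ha hs
  rcases h a b ha hs with h | h
  · left; intro p hp q hq hpq; rw [e p hp.1, e q hq.1]; exact h hp hq hpq
  · right; intro p hp q hq hpq; rw [e p hp.1, e q hq.1]; exact h hp hq hpq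

lemma Good.neg {g g' X S} (h : Good g X S) (e : ∀ t ∈ X, g' t = - g t) : Good g' X S := by
  intro a b ha hs
  rcases h a b ha hs with h | h
  · right; intro p hp q hq hpq; rw [e p hp.1, e q hq.1]; exact neg_le_neg (h hp hq hpq)
  · left; intro p hp q hq hpq; rw [e p hp.1, e q hq.1]; exact neg_le_neg (h hp hq hpq)

lemma mono_of_steps (g : ℕ → ℝ) (x : Vtx) (a b : ℕ) (ha : 1 ≤ a)
    (h : ∀ s ∈ Xdom x, 3 ≤ s → a + 2 ≤ s → s ≤ b → g (s-2) ≤ g s) :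
    MonotoneOn g (Xdom x ∩ Set.Icc a b) := by
  rintro p ⟨⟨hp1, hp2⟩, hp3, hp4⟩ q ⟨⟨hq1, hq2⟩, hq3, hq4⟩ hpq
  obtain ⟨k, rfl⟩ : ∃ k, q = p + 2 * k := ⟨(q-p)/2, by omega⟩
  have : ∀ j ≤ k, g p ≤ g (p + 2*j) := by
    intro j
    induction j with
    | zero => intro _; simp
    | succ j ih =>
      intro hj
      have h1 := ih (by omega)
      have h2 := h (p + 2*(j+1)) ⟨by omega, by push_cast; omega⟩ (by omega) (by omega) (by omega)
      have e : p + 2*(j+1) - 2 = p + 2*j := by omega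
      rw [e] at h2
      exact h1.trans h2
  exact this k le_rfl

lemma anti_of_steps (g : ℕ → ℝ) (x : Vtx) (a b : ℕ) (ha : 1 ≤ a)
    (h : ∀ s ∈ Xdom x, 3 ≤ s → a + 2 ≤ s → s ≤ b → g s ≤ g (s-2)) :
    AntitoneOn g (Xdom x ∩ Set.Icc a b) := by
  have := mono_of_steps (fun t => - g t) x a b ha (fun s h1 h2 h3 h4 => neg_le_neg (h s h1 h2 h3 h4))
  intro p hp q hq hpq
  exact neg_le_neg_iff.1 (this hp hq hpq)

lemma unimodal (g : ℕ → ℝ) (x : Vtx)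
    (h : ∀ s ∈ Xdom x, ∀ r ∈ Xdom x, 3 ≤ s → s < r → g s < g (s-2) → g r ≤ g (r-2)) :
    ∃ s0, 0 < s0 ∧ Good g (Xdom x) {s0} := by
  classical
  by_cases hex : ∃ s, s ∈ Xdom x ∧ 3 ≤ s ∧ g s < g (s-2)
  · obtain ⟨hs1, hs2, hs3⟩ := Nat.find_spec hex
    have hmin : ∀ m, m < Nat.find hex → _ := fun m hm => Nat.find_min hex hm
    generalize Nat.find hex = s at *
    refine ⟨s-2, by omega, ?_⟩
    intro a b ha hab
    have hab := hab (s-2) (by simp)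
    by_cases hb : b ≤ s - 2
    · left
      apply mono_of_steps _ _ _ _ ha
      intro r hr h3 h4 h5
      by_contra! hc
      exact hmin r (by omega) ⟨hr, h3, hc⟩
    · right
      apply anti_of_steps _ _ _ _ ha
      intro r hr h3 h4 h5
      rcases (show s ≤ r by omega).eq_or_lt with rfl | hlt
      · exact hs3.le
      · exact h s hs1 r hr hs2 hlt hs3
  · push Not at hex
    refine ⟨1, one_pos, fun a b ha _ => Or.inl (mono_of_steps _ _ _ _ ha ?_)⟩
    intro s hs h3 _ _
    exact hex s hs h3

lemma bimodal (g : ℕ → ℝ) (x : Vtx)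
    (h : ∀ p ∈ Xdom x, ∀ s ∈ Xdom x, ∀ r ∈ Xdom x, 3 ≤ p → p < s → s < r →
      g (p-2) < g p → g s < g (s-2) → g r ≤ g (r-2)) :
    ∃ s0 s1, 0 < s0 ∧ 0 < s1 ∧ Good g (Xdom x) {s0, s1} := by
  classical
  by_cases hex : ∃ p, p ∈ Xdom x ∧ 3 ≤ p ∧ g (p-2) < g p
  · obtain ⟨hp1, hp2, hp3⟩ := Nat.find_spec hex
    have hpmin : ∀ m, m < Nat.find hex → _ := fun m hm => Nat.find_min hex hm
    generalize Nat.find hex = p at *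
    by_cases hex2 : ∃ s, s ∈ Xdom x ∧ p < s ∧ g s < g (s-2)
    · obtain ⟨hs1, hs2, hs3⟩ := Nat.find_spec hex2
      have hmin : ∀ m, m < Nat.find hex2 → _ := fun m hm => Nat.find_min hex2 hm
      generalize Nat.find hex2 = s at *
      refine ⟨p-2, s-2, by omega, by omega, ?_⟩
      intro a b ha hab
      have hab1 := hab (p-2) (by simp)
      have hab2 := hab (s-2) (by simp)
      by_cases hb1 : b ≤ p - 2
      · right
        apply anti_of_steps _ _ _ _ ha
        intro r hr h3 h4 h5
        by_contra! hc
        exact hpmin r (by omega) ⟨hr, h3, hc⟩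
      by_cases hb : b ≤ s - 2
      · left
        apply mono_of_steps _ _ _ _ ha
        intro r hr h3 h4 h5
        rcases (show p ≤ r by omega).eq_or_lt with rfl | hlt
        · exact hp3.le
        by_contra! hc
        exact hmin r (by omega) ⟨hr, hlt, hc⟩
      · right
        apply anti_of_steps _ _ _ _ ha
        intro r hr h3 h4 h5
        rcases (show s ≤ r by omega).eq_or_lt with rfl | hlt
        · exact hs3.le
        · exact h p hp1 s hs1 r hr hp2 hs2 hlt hp3 hs3
    · push Not at hex2
      refine ⟨p-2, p-2, by omega, by omega, ?_⟩
      intro a b ha hab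
      have hab1 := hab (p-2) (by simp)
      by_cases hb1 : b ≤ p - 2
      · right
        apply anti_of_steps _ _ _ _ ha
        intro r hr h3 h4 h5
        by_contra! hc
        exact hpmin r (by omega) ⟨hr, h3, hc⟩
      · left
        apply mono_of_steps _ _ _ _ ha
        intro r hr h3 h4 h5
        rcases (show p ≤ r by omega).eq_or_lt with rfl | hlt
        · exact hp3.le
        exact hex2 r hr hlt
  · push Not at hex
    refine ⟨1, 1, one_pos, one_pos, fun a b ha _ => Or.inr (anti_of_steps _ _ _ _ ha ?_)⟩
    intro s hs h3 _ _
    exact hex s hs h3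

lemma step_den (s : ℕ) (h3 : 3 ≤ s) : 0 < ((s:ℝ)^2*((s:ℝ)-1)^2*((s:ℝ)-2)^2) := by
  have : (3:ℝ) ≤ s := by exact_mod_cast h3
  have h1 : 0 < (s:ℝ)-1 := by linarith
  have h2 : 0 < (s:ℝ)-2 := by linarith
  positivity

lemma neg_step (x : Vtx) (hx : inV x) (c d : ℝ) (s : ℕ) (hs : s ∈ Xdom x) (h3 : 3 ≤ s)
    (h : GG x c d s < GG x c d (s-2)) : (max |x.1| |x.2| : ℤ) ≤ (s:ℤ) ∧
      QQ (max |x.1| |x.2| : ℤ) (min |x.1| |x.2| : ℤ) c d s < 0 := by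
  have e := GG_step x hx c d s hs h3
  have hd := step_den s h3
  constructor
  · by_contra! hc
    rw [H_zero x s hc] at e; simp at e; linarith
  · by_contra! hc
    have : 0 ≤ H x s * QQ (max |x.1| |x.2| : ℤ) (min |x.1| |x.2| : ℤ) c d s / ((s:ℝ)^2*((s:ℝ)-1)^2*((s:ℝ)-2)^2) :=
      div_nonneg (mul_nonneg (H_nonneg _ _) hc) hd.le
    linarith

lemma pos_step (x : Vtx) (hx : inV x) (c d : ℝ) (s : ℕ) (hs : s ∈ Xdom x) (h3 : 3 ≤ s)
    (h : GG x c d (s-2) < GG x c d s) : (max |x.1| |x.2| : ℤ) ≤ (s:ℤ) ∧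
      0 < QQ (max |x.1| |x.2| : ℤ) (min |x.1| |x.2| : ℤ) c d s := by
  have e := GG_step x hx c d s hs h3
  have hd := step_den s h3
  constructor
  · by_contra! hc
    rw [H_zero x s hc] at e; simp at e; linarith
  · by_contra! hc
    have : H x s * QQ (max |x.1| |x.2| : ℤ) (min |x.1| |x.2| : ℤ) c d s / ((s:ℝ)^2*((s:ℝ)-1)^2*((s:ℝ)-2)^2) ≤ 0 :=
      div_nonpos_of_nonpos_of_nonneg (mul_nonpos_of_nonneg_of_nonpos (H_nonneg _ _) hc) hd.le
    linarith

lemma uni_of_QQ (x : Vtx) (hx : inV x) (c d : ℝ)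
    (h : ∀ s r : ℝ, ((max |x.1| |x.2| : ℤ):ℝ) ≤ s → 3 ≤ s → s < r →
      QQ (max |x.1| |x.2| : ℤ) (min |x.1| |x.2| : ℤ) c d s < 0 →
      QQ (max |x.1| |x.2| : ℤ) (min |x.1| |x.2| : ℤ) c d r ≤ 0) :
    ∃ s0, 0 < s0 ∧ Good (GG x c d) (Xdom x) {s0} := by
  apply unimodal
  intro s hs r hr h3 hsr hlt
  obtain ⟨h1, h2⟩ := neg_step x hx c d s hs h3 hlt
  by_contra! hc
  obtain ⟨h4, h5⟩ := pos_step x hx c d r hr (by omega) hc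
  have := h s r (by exact_mod_cast h1) (by exact_mod_cast h3) (by exact_mod_cast hsr) h2
  linarith

lemma uni_pos (x : Vtx) (hx : inV x) (c d : ℝ) (hc : 0 ≤ c) (hd : 0 ≤ d)
    (h0 : max |x.1| |x.2| = 0 → c = 0 ∧ d = 0) :
    ∃ s0, 0 < s0 ∧ Good (GG x c d) (Xdom x) {s0} := by
  apply uni_of_QQ x hx
  intro s r h1 h2 h3 h4
  have hm : 0 ≤ min |x.1| |x.2| := le_min (abs_nonneg _) (abs_nonneg _)
  have hM : min |x.1| |x.2| ≤ max |x.1| |x.2| := min_le_max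
  by_cases hz : max |x.1| |x.2| = 0
  · obtain ⟨rfl, rfl⟩ := h0 hz
    unfold QQ; simp
  · exact QQ_pos _ _ c d hm hM (by omega) hc hd s r h1 h2 h3 h4

lemma uni_F1 (x : Vtx) (hx : inV x) (u v : ℤ) (hu : u = max |x.1| |x.2|) (hv : v = min |x.1| |x.2|) :
    ∃ s0, 0 < s0 ∧ Good (GG x (u+v) (-(u*v))) (Xdom x) {s0} := by
  apply uni_of_QQ x hx
  intro s r h1 h2 h3 h4
  have hm : 0 ≤ min |x.1| |x.2| := le_min (abs_nonneg _) (abs_nonneg _)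
  have hM : min |x.1| |x.2| ≤ max |x.1| |x.2| := min_le_max
  rw [← hu, ← hv] at *
  exact QQ_F1 u v hm hM s r h1 h3 h4

lemma bi_F4 (x : Vtx) (hx : inV x) (u v : ℤ) (hu : u = max |x.1| |x.2|) (hv : v = min |x.1| |x.2|) :
    ∃ s0 s1, 0 < s0 ∧ 0 < s1 ∧ Good (GG x (u-v) (-(u*v))) (Xdom x) {s0, s1} := by
  apply bimodal
  intro p hp s hs r hr h3 hps hsr g1 g2
  by_contra! g3
  obtain ⟨a1, a2⟩ := pos_step x hx _ _ p hp h3 g1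
  obtain ⟨b1, b2⟩ := neg_step x hx _ _ s hs (by omega) g2
  obtain ⟨c1, c2⟩ := pos_step x hx _ _ r hr (by omega) g3
  have hm : 0 ≤ min |x.1| |x.2| := le_min (abs_nonneg _) (abs_nonneg _)
  have hM : min |x.1| |x.2| ≤ max |x.1| |x.2| := min_le_max
  rw [← hu, ← hv] at *
  have := QQ_F4 u v hm hM p s r (by exact_mod_cast a1) (by exact_mod_cast hps) (by exact_mod_cast hsr) a2 b2
  linarith

lemma GG_neg (x : Vtx) (c d : ℝ) (t : ℕ) : GG x (-c) (-d) t = - GG x c d t := by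
  unfold GG; ring

lemma GG_add (x : Vtx) (c d c' d' : ℝ) (t : ℕ) : GG x c d t + GG x c' d' t = GG x (c+c') (d+d') t := by
  unfold GG; ring

/-- pair sums -/
lemma pair_good (x : Vtx) (hx : inV x) (A B : Vtx) (hA : A ∈ DIRset) (hB : B ∈ DIRset) (hAB : A ≠ B) :
    ∃ s0, 0 < s0 ∧ Good (fun t => INF x A t + INF x B t) (Xdom x) {s0} := by
  obtain ⟨c, d, hcd, e, h0⟩ : ∃ c d : ℝ, (c = 0 ∨ d = 0) ∧ (∀ t ∈ Xdom x, INF x A t + INF x B t = GG x c d t)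
      ∧ (max |x.1| |x.2| = 0 → c = 0 ∧ d = 0) := by
    refine ⟨_, _, ?_, fun t ht => by rw [INF_eq x A hx hA t ht, INF_eq x B hx hB t ht, GG_add], ?_⟩
    · simp only [DIRset, Finset.mem_insert, Finset.mem_singleton] at hA hB
      rcases hA with rfl | rfl | rfl | rfl <;> rcases hB with rfl | rfl | rfl | rfl <;>
        first
        | exact absurd rfl hAB
        | (left; push_cast; ring1)
        | (right; push_cast; ring1)
    · intro h
      have h1 : x.1 = 0 := abs_eq_zero.1 (le_antisymm (h ▸ le_max_left _ _) (abs_nonneg _))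
      have h2 : x.2 = 0 := abs_eq_zero.1 (le_antisymm (h ▸ le_max_right _ _) (abs_nonneg _))
      simp [h1, h2]
  by_cases hs : 0 ≤ c ∧ 0 ≤ d
  · obtain ⟨s0, p, g⟩ := uni_pos x hx c d hs.1 hs.2 h0
    exact ⟨s0, p, g.congr e⟩
  · have : 0 ≤ -c ∧ 0 ≤ -d := by
      rcases hcd with rfl | rfl
      · simp at hs ⊢; linarith
      · simp at hs ⊢; linarith
    obtain ⟨s0, p, g⟩ := uni_pos x hx (-c) (-d) this.1 this.2 (fun h => by simp [h0 h])
    refine ⟨s0, p, g.neg (fun t ht => ?_)⟩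
    rw [e t ht, GG_neg, neg_neg]

lemma singles (x : Vtx) (hx : inV x) : ∃ S : Finset ℕ, (∀ s ∈ S, 0 < s) ∧ S.card ≤ 5 ∧
    ∀ A ∈ DIRset, Good (INF x A) (Xdom x) S := by
  obtain ⟨u, hu⟩ : ∃ u, u = max |x.1| |x.2| := ⟨_, rfl⟩
  obtain ⟨v, hv⟩ : ∃ v, v = min |x.1| |x.2| := ⟨_, rfl⟩
  have hm : 0 ≤ v := hv ▸ le_min (abs_nonneg _) (abs_nonneg _)
  have hM : v ≤ u := hu ▸ hv ▸ min_le_max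
  have hm' : (0:ℝ) ≤ v := by exact_mod_cast hm
  have hM' : (v:ℝ) ≤ u := by exact_mod_cast hM
  have hu' : (0:ℝ) ≤ u := by linarith
  obtain ⟨s1, p1, g1⟩ := uni_F1 x hx u v hu hv
  obtain ⟨s4, s5, p4, p5, g4⟩ := bi_F4 x hx u v hu hv
  obtain ⟨s2, p2, g2⟩ := uni_pos x hx (u+v) (u*v) (by positivity) (by positivity) (by
    intro h; rw [← hu] at h; have : v = 0 := by omega
    simp [h, this])
  obtain ⟨s3, p3, g3⟩ := uni_pos x hx (u-v) (u*v) (by linarith) (by positivity) (by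
    intro h; rw [← hu] at h; have : v = 0 := by omega
    simp [h, this])
  refine ⟨{s1, s2, s3, s4, s5}, ?_, Finset.card_le_five, ?_⟩
  · intro s hs; simp at hs; rcases hs with rfl | rfl | rfl | rfl | rfl <;> assumption
  intro A hA
  have m1 : ({s1} : Finset ℕ) ⊆ {s1, s2, s3, s4, s5} := by intro z; simp; tauto
  have m2 : ({s2} : Finset ℕ) ⊆ {s1, s2, s3, s4, s5} := by intro z; simp; tauto
  have m3 : ({s3} : Finset ℕ) ⊆ {s1, s2, s3, s4, s5} := by intro z; simp; tauto
  have m4 : ({s4, s5} : Finset ℕ) ⊆ {s1, s2, s3, s4, s5} := by intro z; simp; tauto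
  replace g1 := g1.mono m1
  replace g2 := g2.mono m2
  replace g3 := g3.mono m3
  replace g4 := g4.mono m4
  have key : ∀ σ π : ℤ, (σ = u + v ∨ σ = u - v ∨ -σ = u + v ∨ -σ = u - v) → (π = u*v ∨ -π = u*v) →
      Good (GG x (σ:ℝ) (π:ℝ)) (Xdom x) {s1, s2, s3, s4, s5} := by
    intro σ π h1 h2
    have e1 : (σ:ℝ) = u + v ∨ (σ:ℝ) = u - v ∨ (σ:ℝ) = -(u + v) ∨ (σ:ℝ) = -(u - v) := by
      rcases h1 with h | h | h | h
      · left; rw [h]; push_cast; ring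
      · right; left; rw [h]; push_cast; ring
      · right; right; left; rw [← neg_neg σ, h]; push_cast; ring
      · right; right; right; rw [← neg_neg σ, h]; push_cast; ring
    have e2 : (π:ℝ) = u*v ∨ (π:ℝ) = -(u*v) := by
      rcases h2 with h | h
      · left; rw [h]; push_cast; ring
      · right; rw [← neg_neg π, h]; push_cast; ring
    rcases e1 with e1 | e1 | e1 | e1 <;> rcases e2 with e2 | e2 <;> rw [e1, e2]
    · exact g2
    · exact g1
    · exact g3
    · exact g4
    · refine g1.neg (fun t _ => ?_); rw [← GG_neg, neg_neg]
    · refine g2.neg (fun t _ => ?_); rw [← GG_neg]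
    · refine g4.neg (fun t _ => ?_); rw [← GG_neg, neg_neg]
    · refine g3.neg (fun t _ => ?_); rw [← GG_neg]
  refine Good.congr (key (-(A.1*x.1+A.2*x.2)) (A.1*A.2*x.1*x.2) ?_ ?_) (fun t ht => ?_)
  · obtain ⟨ha, hb⟩ := mem_DIR hA
    rcases ha with ha | ha <;> rcases hb with hb | hb <;> rw [ha, hb] <;>
      rcases abs_cases x.1 with ⟨q1, q1'⟩ | ⟨q1, q1'⟩ <;> rcases abs_cases x.2 with ⟨q2, q2'⟩ | ⟨q2, q2'⟩ <;>
      rw [q1, q2] at hu hv <;> omega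
  · have huv : u*v = |x.1*x.2| := by rw [hu, hv, max_mul_min, abs_mul]
    obtain ⟨ha, hb⟩ := mem_DIR hA
    rw [huv]
    rcases ha with ha | ha <;> rcases hb with hb | hb <;> rw [ha, hb] <;>
      rcases abs_choice (x.1*x.2) with h | h <;> rw [h] <;>
      first | (left; ring1) | (right; ring1)
  · rw [INF_eq x A hx hA t ht, Int.cast_neg]

lemma four_sum (x : Vtx) (hx : inV x) (A B C D : Vtx) (h : ({A, B, C, D} : Finset Vtx) = DIRset)
    (t : ℕ) (ht : t ∈ Xdom x) : INF x A t + INF x B t + INF x C t + INF x D t = 0 := by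
  have hc : ({A, B, C, D} : Finset Vtx).card = 4 := by rw [h]; rfl
  have hA : A ∉ ({B, C, D} : Finset Vtx) := by
    intro hh; rw [Finset.insert_eq_of_mem hh] at hc
    have := Finset.card_le_three (a := B) (b := C) (c := D); omega
  rw [Finset.card_insert_of_notMem hA] at hc
  have hB : B ∉ ({C, D} : Finset Vtx) := by
    intro hh; rw [Finset.insert_eq_of_mem hh] at hc
    have := Finset.card_le_two (a := C) (b := D); omega
  rw [Finset.card_insert_of_notMem hB] at hc
  have hC : C ∉ ({D} : Finset Vtx) := by
    intro hh; rw [Finset.insert_eq_of_mem hh] at hc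
    simp at hc
  have e : ∑ P ∈ ({A, B, C, D} : Finset Vtx), INF x P t = ∑ P ∈ DIRset, INF x P t := by rw [h]
  rw [Finset.sum_insert hA, Finset.sum_insert hB, Finset.sum_insert hC, Finset.sum_singleton] at e
  have z : ∑ P ∈ DIRset, INF x P t = 0 := by
    rw [Finset.sum_congr rfl (fun P hP => INF_eq x P hx hP t ht)]
    unfold DIRset
    rw [Finset.sum_insert (by decide), Finset.sum_insert (by decide), Finset.sum_insert (by decide), Finset.sum_singleton]
    unfold GG; push_cast; ring
  linarith

lemma four_facts (A B C D E : Vtx) (h : ({A, B, C, D} : Finset Vtx) = DIRset)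
    (h' : ({B, C, D, E} : Finset Vtx) = DIRset) : A ≠ B ∧ B ≠ C ∧ E = A := by
  have hc : ({A, B, C, D} : Finset Vtx).card = 4 := by rw [h]; rfl
  have hA : A ∉ ({B, C, D} : Finset Vtx) := by
    intro hh; rw [Finset.insert_eq_of_mem hh] at hc
    have := Finset.card_le_three (a := B) (b := C) (c := D); omega
  rw [Finset.card_insert_of_notMem hA] at hc
  have hB : B ∉ ({C, D} : Finset Vtx) := by
    intro hh; rw [Finset.insert_eq_of_mem hh] at hc
    have := Finset.card_le_two (a := C) (b := D); omega
  have hm : A ∈ ({B, C, D, E} : Finset Vtx) := by rw [h', ← h]; simp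
  simp at hA hB hm
  grind

theorem card_EX_le_seven (next : Vtx → Vtx) (hnext : IsRotorSequence next)
    (x : Vtx) (hx : inV x) :
    ∃ S : Finset ℕ, (∀ s ∈ S, 0 < s) ∧ S.card ≤ 7 ∧
      ∀ A ∈ DIRset, ∀ l : ℕ, 1 ≤ l → l ≤ 3 →
        ∀ a b : ℕ, 1 ≤ a → (∀ s ∈ S, ¬(a < s ∧ s < b)) →
          MonoOrAntiOn (fun t => ∑ i ∈ Finset.range l, INF x (next^[i] A) t)
            (Xdom x ∩ Set.Icc a b) := by
  obtain ⟨S, hS, hcard, hsing⟩ := singles x hx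
  obtain ⟨A, hA⟩ : ∃ A, A ∈ DIRset := ⟨(1,1), by decide⟩
  obtain ⟨B, hB⟩ : ∃ B, B = next A := ⟨_, rfl⟩
  obtain ⟨C, hC⟩ : ∃ C, C = next B := ⟨_, rfl⟩
  obtain ⟨D, hD⟩ : ∃ D, D = next C := ⟨_, rfl⟩
  have hset := hnext A hA
  simp only [Function.iterate_succ, Function.iterate_zero, Function.comp, id] at hset
  rw [← hB, ← hC, ← hD] at hset
  have hBm : B ∈ DIRset := by rw [← hset]; simp
  have hCm : C ∈ DIRset := by rw [← hset]; simp
  have hDm : D ∈ DIRset := by rw [← hset]; simp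
  have hset2 := hnext B hBm
  simp only [Function.iterate_succ, Function.iterate_zero, Function.comp, id] at hset2
  rw [← hC, ← hD] at hset2
  obtain ⟨hAB, hBC, hE⟩ := four_facts A B C D _ hset hset2
  obtain ⟨s1, p1, g1⟩ := pair_good x hx A B hA hBm hAB
  obtain ⟨s2, p2, g2⟩ := pair_good x hx B C hBm hCm hBC
  have zero := four_sum x hx A B C D hset
  refine ⟨S ∪ {s1, s2}, ?_, ?_, ?_⟩
  · intro s hs
    simp only [Finset.mem_union, Finset.mem_insert, Finset.mem_singleton] at hs
    rcases hs with h | rfl | rfl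
    · exact hS s h
    · exact p1
    · exact p2
  · have := Finset.card_union_le S {s1, s2}
    have := Finset.card_le_two (a := s1) (b := s2)
    omega
  intro P hP l hl1 hl3
  have hsing' : ∀ P ∈ DIRset, Good (INF x P) (Xdom x) (S ∪ {s1, s2}) :=
    fun P hP => (hsing P hP).mono Finset.subset_union_left
  replace g1 : Good _ _ (S ∪ {s1, s2}) := g1.mono (by intro z hz; simp at hz ⊢; tauto)
  replace g2 : Good _ _ (S ∪ {s1, s2}) := g2.mono (by intro z hz; simp at hz ⊢; tauto)
  change Good _ _ _
  rw [← hset] at hP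
  simp only [Finset.mem_insert, Finset.mem_singleton] at hP
  have hl : l = 1 ∨ l = 2 ∨ l = 3 := by omega
  rcases hl with rfl | rfl | rfl
  · refine Good.congr (hsing' P ?_) (fun t _ => by simp)
    rw [← hset]; simpa using hP
  · rcases hP with rfl | rfl | rfl | rfl
    · exact g1.congr (fun t _ => by simp [Finset.sum_range_succ, ← hB])
    · exact g2.congr (fun t _ => by simp [Finset.sum_range_succ, ← hC])
    · refine g1.neg (fun t ht => ?_)
      have := zero t ht
      simp [Finset.sum_range_succ, ← hD]; linarith
    · refine g2.neg (fun t ht => ?_)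
      have := zero t ht
      simp [Finset.sum_range_succ, hE]; linarith
  · rcases hP with rfl | rfl | rfl | rfl
    · refine (hsing' D hDm).neg (fun t ht => ?_)
      have := zero t ht
      simp [Finset.sum_range_succ, ← hB, ← hC]; linarith
    · refine (hsing' A hA).neg (fun t ht => ?_)
      have := zero t ht
      simp [Finset.sum_range_succ, ← hC, ← hD]; linarith
    · refine (hsing' B hBm).neg (fun t ht => ?_)
      have := zero t ht
      simp [Finset.sum_range_succ, ← hD, hE]; linarith
    · refine (hsing' C hCm).neg (fun t ht => ?_)
      have := zero t ht
      simp [Finset.sum_range_succ, hE, ← hB]; linarith
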